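/- arXiv:1907.00222 — 2 statements merged into one kernel-verified Lean document; each statement's English description precedes it below -/
import Mathlib

section
/- Let (Ω, 𝓕, μ) be a probability space, let m ≥ 1, and for each j ∈ {1,…,m} let (Xⱼₙ)ₙ be a sequence of real-valued random variables on Ω converging in probability (as n → ∞) to the constant cⱼ ∈ ℝ. Let β₀ ∈ ℝ and suppose strictly more than half of the limit constants equal β₀, i.e., 2 * #{j : cⱼ = β₀} > m. Then the sequence of sample medians, ω ↦ median(X₁ₙ(ω), …, Xₘₙ(ω)), converges in probability to β₀ as n → ∞. -/
open MeasureTheory Filter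

/-- The sample median of a finite multiset of reals: the value at (0-based) index
`⌊card/2⌋` after sorting in non-decreasing order (with default value `0` for the
empty multiset, a case that never occurs below). -/
noncomputable def medianMultiset (s : Multiset ℝ) : ℝ :=
  (s.sort (· ≤ ·)).getD (Multiset.card s / 2) 0

/-- The sample median of a finite family of reals indexed by `Fin m`. -/
noncomputable def medianTuple {m : ℕ} (v : Fin m → ℝ) : ℝ :=
  medianMultiset ((Finset.univ : Finset (Fin m)).val.map v)

open Classical in
/-- The entry of a sorted list at half its length lies in every order-connected set that contains
a strict majority of the entries. -/
theorem List.getElem_half_mem_of_majority {α : Type*} [Preorder α] {l : List α}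
    (hl : l.Pairwise (· ≤ ·)) {S : Set α} (hS : S.OrdConnected)
    (hcount : l.length < 2 * l.countP (· ∈ S)) (hlt : l.length / 2 < l.length) :
    l[l.length / 2] ∈ S := by
  have hle : ∀ i j (hi : i < l.length) (hj : j < l.length), i ≤ j → l[i] ≤ l[j] := by
    intro i j hi hj hij
    rcases hij.eq_or_lt with rfl | h
    · exact le_rfl
    · exact List.pairwise_iff_getElem.mp hl i j hi hj h
  have hlow : 0 < (l.take (l.length / 2 + 1)).countP (· ∈ S) := by
    have h₁ := congrArg (List.countP (· ∈ S)) (List.take_append_drop (l.length / 2 + 1) l)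
    rw [List.countP_append] at h₁
    have h₂ := List.countP_le_length (p := (· ∈ S)) (l := l.drop (l.length / 2 + 1))
    rw [List.length_drop] at h₂
    lia
  have hhigh : 0 < (l.drop (l.length / 2)).countP (· ∈ S) := by
    have h₁ := congrArg (List.countP (· ∈ S)) (List.take_append_drop (l.length / 2) l)
    rw [List.countP_append] at h₁
    have h₂ := List.countP_le_length (p := (· ∈ S)) (l := l.take (l.length / 2))
    rw [List.length_take] at h₂
    lia
  obtain ⟨a, ha, haS⟩ := List.countP_pos_iff.mp hlow
  obtain ⟨b, hb, hbS⟩ := List.countP_pos_iff.mp hhigh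
  obtain ⟨i, hi, rfl⟩ := List.mem_take_iff_getElem.mp ha
  obtain ⟨j, hj, rfl⟩ := List.mem_drop_iff_getElem.mp hb
  exact hS.out (of_decide_eq_true haS) (of_decide_eq_true hbS)
    ⟨hle _ _ _ _ (by lia), hle _ _ _ _ (by lia)⟩

open Classical in
theorem medianMultiset_mem_of_majority {s : Multiset ℝ} {S : Set ℝ} (hS : S.OrdConnected)
    (hcount : Multiset.card s < 2 * s.countP (· ∈ S)) : medianMultiset s ∈ S := by
  have hlen : (s.sort (· ≤ ·)).length = Multiset.card s := Multiset.length_sort ..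
  have hpos : 0 < Multiset.card s := by
    have := Multiset.countP_le_card (· ∈ S) s
    lia
  have hcountP : (s.sort (· ≤ ·)).countP (· ∈ S) = s.countP (· ∈ S) := by
    rw [← Multiset.coe_countP, Multiset.sort_eq]
  have hlt : (s.sort (· ≤ ·)).length / 2 < (s.sort (· ≤ ·)).length := by lia
  have hmem := List.getElem_half_mem_of_majority (Multiset.pairwise_sort s (· ≤ ·)) hS
    (by lia) hlt
  rw [medianMultiset, ← hlen, List.getD_eq_getElem _ _ hlt]
  exact hmem

theorem medianTuple_mem_of_majority {m : ℕ} {v : Fin m → ℝ} {S : Set ℝ} (hS : S.OrdConnected)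
    {J : Finset (Fin m)} (hJ : ∀ j ∈ J, v j ∈ S) (hcard : m < 2 * J.card) :
    medianTuple v ∈ S := by
  classical
  refine medianMultiset_mem_of_majority hS ?_
  have hle : J.card ≤ (Finset.univ.filter fun j => v j ∈ S).card :=
    Finset.card_le_card fun j hj => by simpa using hJ j hj
  rw [Multiset.countP_map, Multiset.card_map]
  change Finset.univ.card < 2 * (Finset.univ.filter fun j => v j ∈ S).card
  rw [Finset.card_univ, Fintype.card_fin]
  lia

/-- If each of `m ≥ 1` sequences of random variables `Xⱼₙ` converges in probability to a
constant `cⱼ`, and strictly more than half of the constants equal `β₀`, then the sequence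
of sample medians `ω ↦ median (X₁ₙ(ω), …, Xₘₙ(ω))` converges in probability to `β₀`. -/
theorem tendstoInMeasure_median_of_majority
    {Ω : Type*} [MeasurableSpace Ω] (μ : Measure Ω) [IsProbabilityMeasure μ]
    (m : ℕ) (hm : 1 ≤ m) (X : Fin m → ℕ → Ω → ℝ) (c : Fin m → ℝ)
    (hconv : ∀ j : Fin m,
      TendstoInMeasure μ (fun n => X j n) atTop (fun _ => c j))
    (β₀ : ℝ)
    (hmaj : 2 * Nat.card {j : Fin m // c j = β₀} > m) :
    TendstoInMeasure μ
      (fun n ω => medianTuple (fun j => X j n ω)) atTop (fun _ => β₀) := by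
  classical
  rw [tendstoInMeasure_iff_dist]
  intro ε hε
  set J : Finset (Fin m) := Finset.univ.filter fun j => c j = β₀
  have hcard : m < 2 * J.card := by
    rwa [Nat.card_eq_fintype_card, Fintype.card_subtype] at hmaj
  have hsum : Tendsto (fun n => ∑ j ∈ J, μ {ω | ε ≤ dist (X j n ω) (c j)}) atTop (nhds 0) := by
    simpa using tendsto_finsetSum J fun j _ => tendstoInMeasure_iff_dist.mp (hconv j) ε hε
  refine tendsto_of_tendsto_of_tendsto_of_le_of_le tendsto_const_nhds hsum
    (fun _ => zero_le) fun n => ?_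
  refine (measure_mono ?_).trans
    (measure_biUnion_finset_le J fun j => {ω | ε ≤ dist (X j n ω) (c j)})
  intro ω hω
  by_contra hnot
  simp only [Set.mem_iUnion, Set.mem_ofPred_eq, not_exists, not_le] at hnot hω
  have hball : (Metric.ball β₀ ε).OrdConnected := by
    rw [Real.ball_eq_Ioo]
    exact Set.ordConnected_Ioo
  have hmem : medianTuple (fun j => X j n ω) ∈ Metric.ball β₀ ε := by
    refine medianTuple_mem_of_majority hball (fun j hj => ?_) hcard
    have hc : c j = β₀ := (Finset.mem_filter.mp hj).2
    exact hc ▸ hnot j hj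
  exact hω.not_gt hmem
end

section
/- (Consistency of the vector of marginal medians.) Let (Ω, 𝓕, μ) be a probability space, let J and P be positive integers with P ≤ J, and index the just-identified models by the P-element subsets S of {1,…,J}. For each such subset S and each coordinate p ∈ {1,…,P}, let (β̂ₙ^{S,p})ₙ be a sequence of real random variables on Ω converging in probability to β₀(p) + d(S,p), where β₀ : Fin P → ℝ is the true coefficient vector and d(S,p) ∈ ℝ is the asymptotic inconsistency of model S in coordinate p. Let V ⊆ {1,…,J} be a set of 'valid' indices with |V| = g, and suppose d(S,p) = 0 for every coordinate p whenever S ⊆ V. If the qualified majority condition 2 * C(g,P) > C(J,P) holds (where C denotes the binomial coefficient), then for each coordinate p the marginal median — the median over all C(J,P) subsets S of the estimates β̂ₙ^{S,p} — converges in probability to β₀(p) as n → ∞. -/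
open MeasureTheory Filter

/-- A property closed upwards that holds for more than half of the elements of a multiset
holds for its median. -/
theorem medianMultiset_of_monotone (s : Multiset ℝ) (q : ℝ → Prop) [DecidablePred q]
    (hq : Monotone q) (h : Multiset.card s < 2 * s.countP q) : q (medianMultiset s) := by
  have hsort := s.pairwise_sort (· ≤ ·)
  have hlen : (s.sort (· ≤ ·)).length = Multiset.card s := s.length_sort (· ≤ ·)
  have hcount : s.countP q = (s.sort (· ≤ ·)).countP q := by
    conv_lhs => rw [← s.sort_eq (· ≤ ·), Multiset.coe_countP]
  have hle := s.countP_le_card q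
  unfold medianMultiset
  generalize s.sort (· ≤ ·) = l at *
  set k := Multiset.card s / 2 with hk
  have hkl : k < l.length := by omega
  rw [List.getD_eq_getElem _ _ hkl]
  by_contra hn
  have htake : (l.take (k + 1)).countP q = 0 := by
    rw [List.countP_eq_zero]
    intro a ha
    obtain ⟨i, hi, rfl⟩ := List.mem_take_iff_getElem.1 ha
    simp only [decide_eq_true_eq]
    exact fun hqi => hn (hq (hsort.rel_get_of_le (a := ⟨i, by omega⟩) (b := ⟨k, hkl⟩)
      (Fin.mk_le_mk.2 (by omega))) hqi)
  have hdrop := List.countP_le_length (p := fun x => decide (q x)) (l := l.drop (k + 1))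
  have hsplit : l.countP q = (l.take (k + 1)).countP q + (l.drop (k + 1)).countP q := by
    rw [← List.countP_append, List.take_append_drop]
  rw [List.length_drop] at hdrop
  omega

/-- A property closed downwards that holds for more than half of the elements of a multiset
holds for its median. -/
theorem medianMultiset_of_antitone (s : Multiset ℝ) (q : ℝ → Prop) [DecidablePred q]
    (hq : Antitone q) (h : Multiset.card s < 2 * s.countP q) : q (medianMultiset s) := by
  have hsort := s.pairwise_sort (· ≤ ·)
  have hlen : (s.sort (· ≤ ·)).length = Multiset.card s := s.length_sort (· ≤ ·)
  have hcount : s.countP q = (s.sort (· ≤ ·)).countP q := by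
    conv_lhs => rw [← s.sort_eq (· ≤ ·), Multiset.coe_countP]
  have hle := s.countP_le_card q
  unfold medianMultiset
  generalize s.sort (· ≤ ·) = l at *
  set k := Multiset.card s / 2 with hk
  have hkl : k < l.length := by omega
  rw [List.getD_eq_getElem _ _ hkl]
  by_contra hn
  have hdrop : (l.drop k).countP q = 0 := by
    rw [List.countP_eq_zero]
    intro a ha
    obtain ⟨i, hi, rfl⟩ := List.mem_drop_iff_getElem.1 ha
    simp only [decide_eq_true_eq]
    exact fun hqi => hn (hq (hsort.rel_get_of_le (a := ⟨k, hkl⟩) (b := ⟨k + i, by omega⟩)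
      (Fin.mk_le_mk.2 (by omega))) hqi)
  have htake := List.countP_le_length (p := fun x => decide (q x)) (l := l.take k)
  have hsplit : l.countP q = (l.take k).countP q + (l.drop k).countP q := by
    rw [← List.countP_append, List.take_append_drop]
  rw [List.length_take] at htake
  omega

/-- If more than half of the values of a finite family lie within `ε` of `c`, so does their
median. -/
theorem dist_medianMultiset_map_lt {ι : Type*} (A B : Finset ι) (hBA : B ⊆ A)
    (hcard : A.card < 2 * B.card) (f : ι → ℝ) (c ε : ℝ) (hf : ∀ i ∈ B, dist (f i) c < ε) :
    dist (medianMultiset (A.val.map f)) c < ε := by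
  have majority (q : ℝ → Prop) [DecidablePred q] (hq : ∀ i ∈ B, q (f i)) :
      Multiset.card (A.val.map f) < 2 * (A.val.map f).countP q := by
    have hB : B.card ≤ (A.val.map f).countP q := by
      rw [Multiset.countP_map]
      exact Finset.card_le_card (t := A.filter fun i => q (f i)) fun i hi =>
        Finset.mem_filter.2 ⟨hBA hi, hq i hi⟩
    rw [Multiset.card_map, Finset.card_val]
    omega
  have hlow : c - ε < medianMultiset (A.val.map f) :=
    medianMultiset_of_monotone _ (c - ε < ·) (fun _ _ hab h => lt_of_lt_of_le h hab)
      (majority _ fun i hi => by linarith [(abs_lt.1 (hf i hi)).1])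
  have hupp : medianMultiset (A.val.map f) < c + ε :=
    medianMultiset_of_antitone _ (· < c + ε) (fun _ _ hab h => lt_of_le_of_lt hab h)
      (majority _ fun i hi => by linarith [(abs_lt.1 (hf i hi)).2])
  exact abs_lt.2 ⟨by linarith, by linarith⟩

/-- Consistency of the vector of marginal medians.  Index the just-identified models by
the `P`-element subsets `S` of the `J` instruments.  If for each such `S` and each
coordinate `p` the estimator sequence `βhat S p n` converges in probability to
`β₀ p + d S p`, the inconsistency `d S p` vanishes for every model using only valid
instruments (`S ⊆ V`, `V.card = g`), and the qualified majority condition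
`2 * C(g,P) > C(J,P)` holds, then each marginal median — the median over all `C(J,P)`
subsets `S` of the estimates in coordinate `p` — converges in probability to `β₀ p`. -/
theorem tendstoInMeasure_marginalMedian_of_qualifiedMajority
    {Ω : Type*} [MeasurableSpace Ω] (μ : Measure Ω) [IsProbabilityMeasure μ]
    (J P : ℕ) (hP : 0 < P) (hPJ : P ≤ J)
    (βhat : Finset (Fin J) → Fin P → ℕ → Ω → ℝ)
    (β₀ : Fin P → ℝ) (d : Finset (Fin J) → Fin P → ℝ)
    (hconv : ∀ S : Finset (Fin J), S.card = P → ∀ p : Fin P,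
      TendstoInMeasure μ (fun n => βhat S p n) atTop (fun _ => β₀ p + d S p))
    (V : Finset (Fin J)) (g : ℕ) (hV : V.card = g)
    (hvalid : ∀ S : Finset (Fin J), S.card = P → S ⊆ V → ∀ p : Fin P, d S p = 0)
    (hmaj : 2 * Nat.choose g P > Nat.choose J P) :
    ∀ p : Fin P,
      TendstoInMeasure μ
        (fun n ω =>
          medianMultiset
            (((Finset.univ : Finset (Fin J)).powersetCard P).val.map
              (fun S => βhat S p n ω)))
        atTop (fun _ => β₀ p) := by
  intro p
  rw [tendstoInMeasure_iff_dist]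
  intro ε hε
  have hlim : Tendsto
      (fun n => ∑ S ∈ V.powersetCard P, μ {ω | ε ≤ dist (βhat S p n ω) (β₀ p)})
      atTop (nhds 0) := by
    rw [← Finset.sum_const_zero (s := V.powersetCard P)]
    refine tendsto_finsetSum _ fun S hS => ?_
    obtain ⟨hSV, hSP⟩ := Finset.mem_powersetCard.1 hS
    have hS := tendstoInMeasure_iff_dist.1 (hconv S hSP p) ε hε
    simpa only [hvalid S hSP hSV p, add_zero] using hS
  refine tendsto_of_tendsto_of_tendsto_of_le_of_le tendsto_const_nhds hlim
    (fun _ => zero_le) fun n => ?_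
  refine (measure_mono fun ω hω => ?_).trans (measure_biUnion_finset_le _ _)
  simp only [Set.mem_iUnion, Set.mem_ofPred_eq, exists_prop] at hω ⊢
  by_contra! hclose
  refine hω.not_gt (dist_medianMultiset_map_lt _ (V.powersetCard P)
    (Finset.powersetCard_mono (Finset.subset_univ V)) ?_ _ _ _ hclose)
  simpa [Finset.card_powersetCard, hV] using hmaj
end
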